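/- arXiv:2306.10050 — 9 statements merged into one kernel-verified Lean document; each statement's English description precedes it below -/
import Mathlib

section
/- Let N, M be positive integers, r ∈ ℝ_{≥0}^N, p ∈ Δ_M, y ∈ [0,1]^{N×M}, and set R_{i,j} = r_i p_j y_{i,j}. For each j, let i*_j ∈ argmax_i R_{i,j}, define x^opt ∈ Δ_N^M by x^opt_{i,j} = 1 if i = i*_j and 0 otherwise, and set OPT = ∑_{j=1}^M R_{i*_j, j}; assume OPT > 0. Let L ∈ ℝ^{N×M}, U ∈ ℝ^{N×M}, f^I, f^U ∈ Δ_N^M, and δ^I, δ^U ∈ [0,1], and let F = { x ∈ Δ_N^M : L_{i,:}ᵀ x_{i,:} ≥ δ^I · L_{i,:}ᵀ f^I_{i,:} for all i ∈ [N], and U_{:,j}ᵀ x_{:,j} ≥ δ^U · U_{:,j}ᵀ f^U_{:,j} for all j ∈ [M] } be nonempty, with FAIR = max_{x ∈ F} REV(x). Let V = max{ max_{i∈[N]} (δ^I · L_{i,:}ᵀ f^I_{i,:} − L_{i,:}ᵀ x^opt_{i,:})⁺, max_{j∈[M]} (δ^U · U_{:,j}ᵀ f^U_{:,j} − U_{:,j}ᵀ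 x^opt_{:,j})⁺ }, and suppose H ≥ 0 is such that there exists x' ∈ F with ‖x' − x^opt‖_∞ ≤ H · V (a Hoffman-type bound for F at x^opt). Then the price of fairness satisfies (OPT − FAIR)/OPT ≤ H · V. -/
open Finset

/-- Price-of-fairness bound (Theorem EC.1). -/
theorem price_of_fairness_bound
    (N M : ℕ) (hN : 0 < N) (hM : 0 < M)
    (r : Fin N → ℝ) (hr : ∀ i, 0 ≤ r i)
    (p : Fin M → ℝ) (hp0 : ∀ j, 0 ≤ p j) (hpsum : ∑ j, p j = 1)
    (y : Fin N → Fin M → ℝ) (hy0 : ∀ i j, 0 ≤ y i j) (hy1 : ∀ i j, y i j ≤ 1)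
    (R : Fin N → Fin M → ℝ) (hR : ∀ i j, R i j = r i * p j * y i j)
    (istar : Fin M → Fin N) (histar : ∀ j i, R i j ≤ R (istar j) j)
    (xopt : Fin N → Fin M → ℝ)
    (hxopt : ∀ i j, xopt i j = if i = istar j then (1 : ℝ) else 0)
    (OPT : ℝ) (hOPT : OPT = ∑ j, R (istar j) j) (hOPTpos : 0 < OPT)
    (L U fI fU : Fin N → Fin M → ℝ)
    (hfI : (∀ i j, 0 ≤ fI i j) ∧ ∀ j, ∑ i, fI i j = 1)
    (hfU : (∀ i j, 0 ≤ fU i j) ∧ ∀ j, ∑ i, fU i j = 1)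
    (δI δU : ℝ) (hδI0 : 0 ≤ δI) (hδI1 : δI ≤ 1) (hδU0 : 0 ≤ δU) (hδU1 : δU ≤ 1)
    (F : Set (Fin N → Fin M → ℝ))
    (hF : F = {x | ((∀ i j, 0 ≤ x i j) ∧ ∀ j, ∑ i, x i j = 1) ∧
        (∀ i, δI * ∑ j, L i j * fI i j ≤ ∑ j, L i j * x i j) ∧
        (∀ j, δU * ∑ i, U i j * fU i j ≤ ∑ i, U i j * x i j)})
    (hFne : F.Nonempty)
    (FAIR : ℝ)
    (hFAIR : IsGreatest ((fun x => ∑ i, ∑ j, R i j * x i j) '' F) FAIR)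
    (V : ℝ)
    (hV : V = max
      (Finset.univ.sup' (Finset.univ_nonempty_iff.mpr ⟨⟨0, hN⟩⟩)
        (fun i => max (δI * ∑ j, L i j * fI i j - ∑ j, L i j * xopt i j) 0))
      (Finset.univ.sup' (Finset.univ_nonempty_iff.mpr ⟨⟨0, hM⟩⟩)
        (fun j => max (δU * ∑ i, U i j * fU i j - ∑ i, U i j * xopt i j) 0)))
    (H : ℝ) (hH : 0 ≤ H)
    (hHoffman : ∃ x' ∈ F, ‖x' - xopt‖ ≤ H * V) :
    (OPT - FAIR) / OPT ≤ H * V := by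
  obtain ⟨x', hx'F, hx'⟩ := hHoffman
  obtain ⟨⟨hx0, -⟩, -⟩ := hF ▸ hx'F
  have hR0 : ∀ i j, 0 ≤ R i j := fun i j => by
    rw [hR]
    exact mul_nonneg (mul_nonneg (hr i) (hp0 j)) (hy0 i j)
  have hclose : ∀ j, 1 - H * V ≤ x' (istar j) j := fun j => by
    have hnorm : ‖(x' - xopt) (istar j) j‖ ≤ H * V :=
      (norm_le_pi_norm _ j).trans ((norm_le_pi_norm _ (istar j)).trans hx')
    rw [Pi.sub_apply, Pi.sub_apply, hxopt, if_pos rfl, Real.norm_eq_abs] at hnorm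
    linarith [(abs_le.mp hnorm).1]
  have hlower : OPT * (1 - H * V) ≤ FAIR := calc
    OPT * (1 - H * V) = ∑ j, R (istar j) j * (1 - H * V) := by rw [hOPT, sum_mul]
    _ ≤ ∑ j, ∑ i, R i j * x' i j := sum_le_sum fun j _ =>
      (mul_le_mul_of_nonneg_left (hclose j) (hR0 _ j)).trans
        (single_le_sum (f := fun i => R i j * x' i j)
          (fun i _ => mul_nonneg (hR0 i j) (hx0 i j)) (mem_univ (istar j)))
    _ = ∑ i, ∑ j, R i j * x' i j := sum_comm
    _ ≤ FAIR := hFAIR.2 ⟨x', hx'F, rfl⟩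
  rw [div_le_iff₀ hOPTpos]
  linarith
end

section
/- Let N, M be positive integers, B, Γ, L̄ ≥ 0, and δ ∈ [0,1]. Let L, L̂ ∈ ℝ^{N×M} with ‖L‖_∞ ≤ L̄, ‖L̂‖_∞ ≤ L̄ and ‖L̂ − L‖_∞ ≤ B·Γ, and let f, f̂ ∈ Δ_N^M with ‖f̂ − f‖_∞ ≤ B·Γ. If x ∈ Δ_N^M satisfies L_{i,:}ᵀ x_{i,:} ≥ δ · L_{i,:}ᵀ f_{i,:} for every i ∈ [N], then for every i ∈ [N], L̂_{i,:}ᵀ x_{i,:} ≥ δ · L̂_{i,:}ᵀ f̂_{i,:} − (M·B + δ·M·B·(L̄ + 1))·Γ. -/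
open Finset

/-- Entries of a real matrix are bounded by its entrywise sup norm. -/
lemma abs_entry_le_of_norm_le {ι κ : Type*} [Fintype ι] [Fintype κ] {A : ι → κ → ℝ} {c : ℝ}
    (h : ‖A‖ ≤ c) (i : ι) (j : κ) : |A i j| ≤ c :=
  ((norm_le_pi_norm (A i) j).trans (norm_le_pi_norm A i)).trans h

/-- a solution satisfying the true item-fairness constraints
satisfies the estimated constraints up to relaxation (M·B + δ·M·B·(L̄+1))·Γ. -/
theorem item_fair_constraint_transfer_true_to_estimated
    (N M : ℕ) (hN : 0 < N) (hM : 0 < M)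
    (B Γ Lbar : ℝ) (hB : 0 ≤ B) (hΓ : 0 ≤ Γ) (hLbar : 0 ≤ Lbar)
    (δ : ℝ) (hδ0 : 0 ≤ δ) (hδ1 : δ ≤ 1)
    (L Lhat : Fin N → Fin M → ℝ)
    (hL : ‖L‖ ≤ Lbar) (hLhat : ‖Lhat‖ ≤ Lbar)
    (hLdiff : ‖Lhat - L‖ ≤ B * Γ)
    (f fhat : Fin N → Fin M → ℝ)
    (hf0 : ∀ i j, 0 ≤ f i j) (hf1 : ∀ i j, f i j ≤ 1) (hfsum : ∀ j, ∑ i, f i j = 1)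
    (hfhat0 : ∀ i j, 0 ≤ fhat i j) (hfhat1 : ∀ i j, fhat i j ≤ 1)
    (hfhatsum : ∀ j, ∑ i, fhat i j = 1)
    (hfdiff : ‖fhat - f‖ ≤ B * Γ)
    (x : Fin N → Fin M → ℝ)
    (hx0 : ∀ i j, 0 ≤ x i j) (hx1 : ∀ i j, x i j ≤ 1) (hxsum : ∀ j, ∑ i, x i j = 1)
    (hcon : ∀ i, δ * ∑ j, L i j * f i j ≤ ∑ j, L i j * x i j) :
    ∀ i, δ * ∑ j, Lhat i j * fhat i j - (M * B + δ * M * B * (Lbar + 1)) * Γ ≤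
      ∑ j, Lhat i j * x i j := by
  intro i
  have key : ∀ j, δ * (Lhat i j * fhat i j) - Lhat i j * x i j ≤
      δ * (L i j * f i j) - L i j * x i j + (B + δ * B * (Lbar + 1)) * Γ := by
    intro j
    have hdiff : |Lhat i j - L i j| ≤ B * Γ := abs_entry_le_of_norm_le hLdiff i j
    have hBΓ : 0 ≤ B * Γ := mul_nonneg hB hΓ
    have hx : -((Lhat i j - L i j) * x i j) ≤ B * Γ := by
      refine (neg_le_abs _).trans ?_
      rw [abs_mul, abs_of_nonneg (hx0 i j)]
      exact (mul_le_mul hdiff (hx1 i j) (hx0 i j) hBΓ).trans_eq (mul_one _)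
    have hf : (Lhat i j - L i j) * f i j ≤ B * Γ := by
      refine (le_abs_self _).trans ?_
      rw [abs_mul, abs_of_nonneg (hf0 i j)]
      exact (mul_le_mul hdiff (hf1 i j) (hf0 i j) hBΓ).trans_eq (mul_one _)
    have hfhat : Lhat i j * (fhat i j - f i j) ≤ Lbar * (B * Γ) := by
      refine (le_abs_self _).trans ?_
      rw [abs_mul]
      exact mul_le_mul (abs_entry_le_of_norm_le hLhat i j)
        (abs_entry_le_of_norm_le hfdiff i j) (abs_nonneg _) hLbar
    linarith [mul_le_mul_of_nonneg_left (add_le_add hf hfhat) hδ0]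
  have hsum := Finset.sum_le_sum fun j (_ : j ∈ Finset.univ) => key j
  simp only [Finset.sum_add_distrib, Finset.sum_sub_distrib, ← Finset.mul_sum, Finset.sum_const,
    Finset.card_univ, Fintype.card_fin, nsmul_eq_mul] at hsum
  linarith [hcon i]
end

section
/- Let N, M be positive integers, B, Γ, L̄, η ≥ 0, and δ ∈ [0,1]. Let L, L̂ ∈ ℝ^{N×M} with ‖L‖_∞ ≤ L̄, ‖L̂‖_∞ ≤ L̄ and ‖L̂ − L‖_∞ ≤ B·Γ, and let f, f̂ ∈ Δ_N^M with ‖f̂ − f‖_∞ ≤ B·Γ. If x ∈ Δ_N^M satisfies L̂_{i,:}ᵀ x_{i,:} ≥ δ · L̂_{i,:}ᵀ f̂_{i,:} − η for every i ∈ [N], then for every i ∈ [N], L_{i,:}ᵀ x_{i,:} ≥ δ · L_{i,:}ᵀ f_{i,:} − η − (M·B + δ·M·B·(L̄ + 1))·Γ. -/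
open Finset

theorem abs_entry_le_norm {ι κ : Type*} [Fintype ι] [Fintype κ] (A : ι → κ → ℝ) (i : ι) (j : κ) :
    |A i j| ≤ ‖A‖ :=
  (norm_le_pi_norm (A i) j).trans (norm_le_pi_norm A i)

theorem sum_mul_le_card_mul {ι : Type*} [Fintype ι] {u v : ι → ℝ} {a b : ℝ}
    (ha : 0 ≤ a) (hu : ∀ j, |u j| ≤ a) (hv : ∀ j, |v j| ≤ b) :
    ∑ j, u j * v j ≤ Fintype.card ι * (a * b) := by
  calc ∑ j, u j * v j ≤ ∑ _j : ι, a * b := Finset.sum_le_sum fun j _ =>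
        (le_abs_self _).trans <| (abs_mul _ _).trans_le <|
          mul_le_mul (hu j) (hv j) (abs_nonneg _) ha
    _ = Fintype.card ι * (a * b) := by simp

/-- a solution satisfying the relaxed estimated item-fairness
constraints satisfies the true constraints up to η + (M·B + δ·M·B·(L̄+1))·Γ. -/
theorem item_fair_constraint_transfer_estimated_to_true
    (N M : ℕ) (hN : 0 < N) (hM : 0 < M)
    (B Γ Lbar η : ℝ) (hB : 0 ≤ B) (hΓ : 0 ≤ Γ) (hLbar : 0 ≤ Lbar) (hη : 0 ≤ η)
    (δ : ℝ) (hδ0 : 0 ≤ δ) (hδ1 : δ ≤ 1)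
    (L Lhat : Fin N → Fin M → ℝ)
    (hL : ‖L‖ ≤ Lbar) (hLhat : ‖Lhat‖ ≤ Lbar)
    (hLdiff : ‖Lhat - L‖ ≤ B * Γ)
    (f fhat : Fin N → Fin M → ℝ)
    (hf0 : ∀ i j, 0 ≤ f i j) (hf1 : ∀ i j, f i j ≤ 1) (hfsum : ∀ j, ∑ i, f i j = 1)
    (hfhat0 : ∀ i j, 0 ≤ fhat i j) (hfhat1 : ∀ i j, fhat i j ≤ 1)
    (hfhatsum : ∀ j, ∑ i, fhat i j = 1)
    (hfdiff : ‖fhat - f‖ ≤ B * Γ)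
    (x : Fin N → Fin M → ℝ)
    (hx0 : ∀ i j, 0 ≤ x i j) (hx1 : ∀ i j, x i j ≤ 1) (hxsum : ∀ j, ∑ i, x i j = 1)
    (hcon : ∀ i, δ * ∑ j, Lhat i j * fhat i j - η ≤ ∑ j, Lhat i j * x i j) :
    ∀ i, δ * ∑ j, L i j * f i j - η - (M * B + δ * M * B * (Lbar + 1)) * Γ ≤
      ∑ j, L i j * x i j := by
  intro i
  have hBΓ : 0 ≤ B * Γ := mul_nonneg hB hΓ
  have hLd (j) : |Lhat i j - L i j| ≤ B * Γ := (abs_entry_le_norm (Lhat - L) i j).trans hLdiff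
  have hfd (j) : |fhat i j - f i j| ≤ B * Γ := (abs_entry_le_norm (fhat - f) i j).trans hfdiff
  have solution_error := sum_mul_le_card_mul (v := x i) (b := 1) hBΓ hLd
    fun j => (abs_of_nonneg (hx0 i j)).trans_le (hx1 i j)
  have outcome_error := sum_mul_le_card_mul (v := fhat i) (b := 1) hBΓ
    (fun j => (abs_sub_comm (L i j) (Lhat i j)).trans_le (hLd j))
    fun j => (abs_of_nonneg (hfhat0 i j)).trans_le (hfhat1 i j)
  have fair_error := sum_mul_le_card_mul hLbar
    (fun j => (abs_entry_le_norm L i j).trans hL)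
    fun j => (abs_sub_comm (f i j) (fhat i j)).trans_le (hfd j)
  simp only [sub_mul, mul_sub, Finset.sum_sub_distrib, Fintype.card_fin]
    at solution_error outcome_error fair_error
  have benchmark_error : δ * (∑ j, L i j * f i j - ∑ j, Lhat i j * fhat i j) ≤
      δ * (M * (Lbar * (B * Γ)) + M * (B * Γ * 1)) :=
    mul_le_mul_of_nonneg_left (by linarith) hδ0
  linarith [hcon i]
end

section
/- Let N, M be positive integers, B, Γ ≥ 0, and δ ∈ [0,1]. Let U, Û ∈ ℝ^{N×M} with ‖Û − U‖_∞ ≤ B·Γ. If x ∈ Δ_N^M satisfies U_{:,j}ᵀ x_{:,j} ≥ δ · max_{i ∈ [N]} U_{i,j} for every j ∈ [M], then for every j ∈ [M], Û_{:,j}ᵀ x_{:,j} ≥ δ · max_{i ∈ [N]} Û_{i,j} − (1 + δ)·B·Γ. -/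
open Finset

/-- a solution satisfying the true user-fairness constraints
satisfies the estimated constraints up to relaxation (1+δ)·B·Γ. -/
theorem user_fair_constraint_transfer_true_to_estimated
    (N M : ℕ) (hN : 0 < N) (hM : 0 < M)
    (B Γ : ℝ) (hB : 0 ≤ B) (hΓ : 0 ≤ Γ)
    (δ : ℝ) (hδ0 : 0 ≤ δ) (hδ1 : δ ≤ 1)
    (U Uhat : Fin N → Fin M → ℝ)
    (hUdiff : ‖Uhat - U‖ ≤ B * Γ)
    (x : Fin N → Fin M → ℝ)
    (hx0 : ∀ i j, 0 ≤ x i j) (hx1 : ∀ i j, x i j ≤ 1) (hxsum : ∀ j, ∑ i, x i j = 1)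
    (hcon : ∀ j, δ * Finset.univ.sup' (Finset.univ_nonempty_iff.mpr ⟨⟨0, hN⟩⟩)
        (fun i => U i j) ≤ ∑ i, U i j * x i j) :
    ∀ j, δ * Finset.univ.sup' (Finset.univ_nonempty_iff.mpr ⟨⟨0, hN⟩⟩)
        (fun i => Uhat i j) - (1 + δ) * B * Γ ≤ ∑ i, Uhat i j * x i j := by
  have habs : ∀ i j, |Uhat i j - U i j| ≤ B * Γ := fun i j =>
    ((norm_le_pi_norm ((Uhat - U) i) j).trans (norm_le_pi_norm (Uhat - U) i)).trans hUdiff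
  intro j
  have hsup : Finset.univ.sup' (Finset.univ_nonempty_iff.mpr ⟨⟨0, hN⟩⟩) (fun i => Uhat i j) ≤
      Finset.univ.sup' (Finset.univ_nonempty_iff.mpr ⟨⟨0, hN⟩⟩) (fun i => U i j) + B * Γ := by
    refine Finset.sup'_le _ _ fun i hi => ?_
    have hle := Finset.le_sup' (fun i => U i j) hi
    have hdiff := (abs_le.mp (habs i j)).2
    linarith
  have hsum : ∑ i, U i j * x i j - B * Γ ≤ ∑ i, Uhat i j * x i j := by
    calc ∑ i, U i j * x i j - B * Γ = ∑ i, (U i j - B * Γ) * x i j := by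
          simp only [sub_mul, Finset.sum_sub_distrib, ← Finset.mul_sum, hxsum, mul_one]
      _ ≤ ∑ i, Uhat i j * x i j := by
          refine Finset.sum_le_sum fun i _ => mul_le_mul_of_nonneg_right ?_ (hx0 i j)
          linarith [(abs_le.mp (habs i j)).1]
  have hmul := mul_le_mul_of_nonneg_left hsup hδ0
  linarith [hcon j]
end

section
/- Let N, M be positive integers, B, Γ, η ≥ 0, and δ ∈ [0,1]. Let U, Û ∈ ℝ^{N×M} with ‖Û − U‖_∞ ≤ B·Γ. If x ∈ Δ_N^M satisfies Û_{:,j}ᵀ x_{:,j} ≥ δ · max_{i ∈ [N]} Û_{i,j} − η for every j ∈ [M], then for every j ∈ [M], U_{:,j}ᵀ x_{:,j} ≥ δ · max_{i ∈ [N]} U_{i,j} − η − (1 + δ)·B·Γ. -/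
open Finset

/-- a solution satisfying the relaxed estimated user-fairness
constraints satisfies the true constraints up to η + (1+δ)·B·Γ. -/
theorem user_fair_constraint_transfer_estimated_to_true
    (N M : ℕ) (hN : 0 < N) (hM : 0 < M)
    (B Γ η : ℝ) (hB : 0 ≤ B) (hΓ : 0 ≤ Γ) (hη : 0 ≤ η)
    (δ : ℝ) (hδ0 : 0 ≤ δ) (hδ1 : δ ≤ 1)
    (U Uhat : Fin N → Fin M → ℝ)
    (hUdiff : ‖Uhat - U‖ ≤ B * Γ)
    (x : Fin N → Fin M → ℝ)
    (hx0 : ∀ i j, 0 ≤ x i j) (hx1 : ∀ i j, x i j ≤ 1) (hxsum : ∀ j, ∑ i, x i j = 1)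
    (hcon : ∀ j, δ * Finset.univ.sup' (Finset.univ_nonempty_iff.mpr ⟨⟨0, hN⟩⟩)
        (fun i => Uhat i j) - η ≤ ∑ i, Uhat i j * x i j) :
    ∀ j, δ * Finset.univ.sup' (Finset.univ_nonempty_iff.mpr ⟨⟨0, hN⟩⟩)
        (fun i => U i j) - η - (1 + δ) * B * Γ ≤ ∑ i, U i j * x i j := by
  intro j
  have hentry : ∀ i, |Uhat i j - U i j| ≤ B * Γ := fun i =>
    ((norm_le_pi_norm ((Uhat - U) i) j).trans (norm_le_pi_norm (Uhat - U) i)).trans hUdiff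
  have hsup : Finset.univ.sup' (Finset.univ_nonempty_iff.mpr ⟨⟨0, hN⟩⟩) (fun i => U i j) ≤
      Finset.univ.sup' (Finset.univ_nonempty_iff.mpr ⟨⟨0, hN⟩⟩) (fun i => Uhat i j) + B * Γ := by
    refine Finset.sup'_le _ _ fun i hi => ?_
    have hle := Finset.le_sup' (fun i => Uhat i j) hi
    have habs := (abs_le.mp (hentry i)).1
    linarith
  have hsum : ∑ i, Uhat i j * x i j ≤ ∑ i, U i j * x i j + B * Γ := by
    calc ∑ i, Uhat i j * x i j ≤ ∑ i, (U i j * x i j + B * Γ * x i j) := by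
          refine Finset.sum_le_sum fun i _ => ?_
          rw [← add_mul]
          refine mul_le_mul_of_nonneg_right ?_ (hx0 i j)
          linarith [(abs_le.mp (hentry i)).2]
      _ = ∑ i, U i j * x i j + B * Γ := by
          rw [Finset.sum_add_distrib, ← Finset.mul_sum, hxsum j, mul_one]
  have hscaled := mul_le_mul_of_nonneg_left hsup hδ0
  linarith [hcon j]
end

section
/- Let N, M be positive integers and define, for L ∈ ℝ^{N×M}, the maxmin social-welfare value z*(L) = max_{x ∈ Δ_N^M} min_{i ∈ [N]} L_{i,:}ᵀ x_{i,:}. Then for all L, L̃ ∈ ℝ^{N×M} with ‖L − L̃‖_∞ ≤ E, we have z*(L) − z*(L̃) ≤ M·E (and hence, by symmetry, |z*(L) − z*(L̃)| ≤ M·E). -/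
open Finset

/-- Replacing the outcome matrix by one at sup distance at most `E` raises the best guaranteed
utility by at most `M * E`. -/
theorem maxmin_value_sub_le {N M : ℕ} (hne : (Finset.univ : Finset (Fin N)).Nonempty)
    {L Lt : Fin N → Fin M → ℝ} {E : ℝ} (hE : ‖L - Lt‖ ≤ E) {zL zLt : ℝ}
    (hzL : zL ∈ {z : ℝ | ∃ x : Fin N → Fin M → ℝ,
        ((∀ i j, 0 ≤ x i j) ∧ ∀ j, ∑ i, x i j = 1) ∧
        z = Finset.univ.inf' hne (fun i => ∑ j, L i j * x i j)})
    (hzLt : zLt ∈ upperBounds {z : ℝ | ∃ x : Fin N → Fin M → ℝ,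
        ((∀ i j, 0 ≤ x i j) ∧ ∀ j, ∑ i, x i j = 1) ∧
        z = Finset.univ.inf' hne (fun i => ∑ j, Lt i j * x i j)}) :
    zL - zLt ≤ M * E := by
  obtain ⟨x, ⟨hx0, hx1⟩, rfl⟩ := hzL
  have hE0 : 0 ≤ E := (norm_nonneg _).trans hE
  have hle : Finset.univ.inf' hne (fun i => ∑ j, L i j * x i j) - M * E ≤
      Finset.univ.inf' hne (fun i => ∑ j, Lt i j * x i j) := by
    refine Finset.le_inf' _ _ fun i _ => ?_
    have hinf := Finset.inf'_le (fun i => ∑ j, L i j * x i j) (Finset.mem_univ i)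
    have hdiff : ∑ j, L i j * x i j - ∑ j, Lt i j * x i j ≤ M * E := by
      rw [← Finset.sum_sub_distrib]
      calc ∑ j, (L i j * x i j - Lt i j * x i j) ≤ ∑ _j : Fin M, E := by
            refine Finset.sum_le_sum fun j _ => ?_
            have hij : L i j - Lt i j ≤ E :=
              (le_abs_self _).trans <|
                ((norm_le_pi_norm ((L - Lt) i) j).trans (norm_le_pi_norm (L - Lt) i)).trans hE
            have hx : x i j ≤ 1 := hx1 j ▸
              Finset.single_le_sum (f := fun i => x i j) (fun k _ => hx0 k j) (Finset.mem_univ i)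
            rw [← sub_mul]
            exact (mul_le_mul_of_nonneg_right hij (hx0 i j)).trans (mul_le_of_le_one_right hE0 hx)
        _ = M * E := by simp
    linarith
  have hub := hzLt ⟨x, ⟨hx0, hx1⟩, rfl⟩
  linarith

/-- Lipschitz continuity of the maxmin social-welfare value in the
outcome matrix, with constant M. -/
theorem maxmin_value_lipschitz
    (N M : ℕ) (hN : 0 < N) (hM : 0 < M)
    (L Lt : Fin N → Fin M → ℝ) (E : ℝ) (hE : ‖L - Lt‖ ≤ E)
    (zL zLt : ℝ)
    (hzL : IsGreatest {z : ℝ | ∃ x : Fin N → Fin M → ℝ,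
        ((∀ i j, 0 ≤ x i j) ∧ ∀ j, ∑ i, x i j = 1) ∧
        z = Finset.univ.inf' (Finset.univ_nonempty_iff.mpr ⟨⟨0, hN⟩⟩)
          (fun i => ∑ j, L i j * x i j)} zL)
    (hzLt : IsGreatest {z : ℝ | ∃ x : Fin N → Fin M → ℝ,
        ((∀ i j, 0 ≤ x i j) ∧ ∀ j, ∑ i, x i j = 1) ∧
        z = Finset.univ.inf' (Finset.univ_nonempty_iff.mpr ⟨⟨0, hN⟩⟩)
          (fun i => ∑ j, Lt i j * x i j)} zLt) :
    zL - zLt ≤ M * E ∧ |zL - zLt| ≤ M * E := by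
  have h := maxmin_value_sub_le _ hE hzL.1 hzLt.2
  have h' := maxmin_value_sub_le _ (norm_sub_rev L Lt ▸ hE) hzLt.1 hzL.2
  exact ⟨h, abs_sub_le_iff.mpr ⟨h, h'⟩⟩
end

section
/- Let N, M be positive integers and L, L̃ ∈ ℝ^{N×M}. Let z*(L) = max_{x ∈ Δ_N^M} min_i L_{i,:}ᵀ x_{i,:} and suppose the maxmin LP under L has a unique optimal solution (f, z*), and let (f̃, z̃*) be an optimal solution of the maxmin LP under L̃. Define D = { (x, z) ∈ Δ_N^M × ℝ : L_{i,:}ᵀ x_{i,:} ≥ z for all i ∈ [N], and z ≥ z* }, and suppose H ≥ 0 satisfies the Hoffman-type bound inf_{(x,z) ∈ D} ‖(x, z) − (f̃, z̃*)‖_∞ ≤ H · max{ max_{i ∈ [N]} (z̃* − L_{i,:}ᵀ f̃_{i,:})⁺, (z* − z̃*)⁺ }. Then ‖f − f̃‖_∞ ≤ H · M · ‖L − L̃‖_∞. -/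
open Finset

/-- Feasibility for the maxmin item-fairness LP under outcome matrix `L`:
`x ∈ Δ_N^M` and every row outcome is at least `z`. -/
def MaxminFeasible {N M : ℕ} (L : Fin N → Fin M → ℝ)
    (x : Fin N → Fin M → ℝ) (z : ℝ) : Prop :=
  ((∀ i j, 0 ≤ x i j) ∧ ∀ j, ∑ i, x i j = 1) ∧ ∀ i, z ≤ ∑ j, L i j * x i j

namespace MaxminFeasible

variable {N M : ℕ} {L : Fin N → Fin M → ℝ} {x : Fin N → Fin M → ℝ} {z : ℝ}

lemma le_one (h : MaxminFeasible L x z) (i : Fin N) (j : Fin M) : x i j ≤ 1 :=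
  h.1.2 j ▸ Finset.single_le_sum (fun k _ => h.1.1 k j) (Finset.mem_univ i)

/-- Perturbing the outcome matrix from `A` to `B` moves each row outcome of a feasible allocation
by at most `M * ‖A - B‖`. -/
lemma row_outcome_sub_le (h : MaxminFeasible L x z) (A B : Fin N → Fin M → ℝ) (i : Fin N) :
    ∑ j, A i j * x i j - ∑ j, B i j * x i j ≤ M * ‖A - B‖ := by
  have entry (j : Fin M) : A i j * x i j - B i j * x i j ≤ ‖A - B‖ := by
    have hAB : A i j - B i j ≤ ‖A - B‖ :=
      (le_abs_self _).trans ((norm_le_pi_norm ((A - B) i) j).trans (norm_le_pi_norm (A - B) i))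
    nlinarith [h.1.1 i j, h.le_one i j, norm_nonneg (A - B)]
  rw [← Finset.sum_sub_distrib]
  simpa using Finset.sum_le_sum (fun j (_ : j ∈ Finset.univ) => entry j)

/-- A feasible point stays feasible for a perturbed outcome matrix after lowering its value. -/
lemma perturb (h : MaxminFeasible L x z) (A : Fin N → Fin M → ℝ) :
    MaxminFeasible A x (z - M * ‖L - A‖) :=
  ⟨h.1, fun i => by linarith [h.2 i, h.row_outcome_sub_le L A i]⟩

end MaxminFeasible

/-- local Lipschitzness of the maxmin item-fair solution via a
Hoffman-type bound. -/
theorem maxmin_fair_solution_lipschitz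
    (N M : ℕ) (hN : 0 < N) (hM : 0 < M)
    (L Lt : Fin N → Fin M → ℝ)
    (f ft : Fin N → Fin M → ℝ) (zstar zt : ℝ)
    -- (f, z*) is an optimal solution of the maxmin LP under L …
    (hfeas : MaxminFeasible L f zstar)
    (hopt : ∀ x z, MaxminFeasible L x z → z ≤ zstar)
    -- … and it is the unique optimal solution
    (huniq : ∀ x, MaxminFeasible L x zstar → x = f)
    -- (f̃, z̃*) is an optimal solution of the maxmin LP under L̃
    (hfeasT : MaxminFeasible Lt ft zt)
    (hoptT : ∀ x z, MaxminFeasible Lt x z → z ≤ zt)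
    -- Hoffman-type bound for D = {(x,z) feasible under L, z ≥ z*} at (f̃, z̃*)
    (H : ℝ) (hH : 0 ≤ H)
    (hHoffman : sInf {d : ℝ | ∃ x z, (MaxminFeasible L x z ∧ zstar ≤ z) ∧
        d = max ‖x - ft‖ |z - zt|} ≤
      H * max
        (Finset.univ.sup' (Finset.univ_nonempty_iff.mpr ⟨⟨0, hN⟩⟩)
          (fun i => max (zt - ∑ j, L i j * ft i j) 0))
        (max (zstar - zt) 0)) :
    ‖f - ft‖ ≤ H * M * ‖L - Lt‖ := by
  have hset : {d : ℝ | ∃ x z, (MaxminFeasible L x z ∧ zstar ≤ z) ∧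
      d = max ‖x - ft‖ |z - zt|} = {max ‖f - ft‖ |zstar - zt|} := by
    ext d
    constructor
    · rintro ⟨x, z, ⟨hx, hz⟩, rfl⟩
      obtain rfl : z = zstar := le_antisymm (hopt x z hx) hz
      rw [huniq x hx]
      rfl
    · rintro rfl
      exact ⟨f, zstar, ⟨hfeas, le_rfl⟩, rfl⟩
  rw [hset, csInf_singleton] at hHoffman
  have hbound : 0 ≤ M * ‖L - Lt‖ := by positivity
  rw [mul_assoc]
  refine (le_max_left _ _).trans (hHoffman.trans (mul_le_mul_of_nonneg_left ?_ hH))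
  refine max_le (Finset.sup'_le _ _ fun i _ => max_le ?_ hbound) (max_le ?_ hbound)
  · rw [norm_sub_rev]
    linarith [hfeasT.2 i, hfeasT.row_outcome_sub_le Lt L i]
  · linarith [hoptT _ _ (hfeas.perturb Lt)]
end

section
/- Fix positive integers N, M, constants L̄ > 0 and Δ > 0, and set Γ = 2·M·L̄ + Δ. For L ∈ ℝ_{≥0}^{N×M} with ‖L‖_∞ ≤ L̄, define the Hooker–Williams fairness LP value z*(L) as the optimal value of: maximize z over x ∈ Δ_N^M, z ≥ 0, v ∈ ℝ_{≥0}^N, w ≥ 0, and δ ∈ [0,1]^N, subject to (N−1)·Δ + ∑_{i=1}^N v_i ≥ z; L_{i,:}ᵀ x_{i,:} − Δ ≤ v_i ≤ L_{i,:}ᵀ x_{i,:} − Δ·δ_i for all i; and w ≤ v_i ≤ w + (Γ − Δ)·δ_i for all i. Let L, L̃ ∈ ℝ_{≥0}^{N×M} with ‖L‖_∞ ≤ L̄, ‖L̃‖_∞ ≤ L̄, set E = ‖L − L̃‖_∞, and assume M·E < Δ/4 and that both LPs (under L and under L̃) are feasible. Then z*(L) − z*(L̃) ≤ N·M·E. 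-/
open Finset

/-- Feasibility for the Hooker–Williams fairness LP under outcome matrix `L`,
equity threshold `Δ` and big constant `Γ`, with auxiliary variables
`v ∈ ℝ_{≥0}^N`, `w ≥ 0`, `d ∈ [0,1]^N`. -/
def HWFeasible {N M : ℕ} (L : Fin N → Fin M → ℝ) (Δ Γ : ℝ)
    (x : Fin N → Fin M → ℝ) (z : ℝ) (v : Fin N → ℝ) (w : ℝ) (d : Fin N → ℝ) :
    Prop :=
  ((∀ i j, 0 ≤ x i j) ∧ ∀ j, ∑ i, x i j = 1) ∧
  0 ≤ z ∧ (∀ i, 0 ≤ v i) ∧ 0 ≤ w ∧ (∀ i, 0 ≤ d i ∧ d i ≤ 1) ∧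
  z ≤ (N - 1 : ℝ) * Δ + ∑ i, v i ∧
  (∀ i, (∑ j, L i j * x i j) - Δ ≤ v i ∧ v i ≤ (∑ j, L i j * x i j) - Δ * d i) ∧
  (∀ i, w ≤ v i ∧ v i ≤ w + (Γ - Δ) * d i)

/-- Entries of a column-stochastic matrix are at most one. -/
lemma entry_le_one_of_column_sum {N M : ℕ} {x : Fin N → Fin M → ℝ}
    (hx0 : ∀ i j, 0 ≤ x i j) (hx1 : ∀ j, ∑ i, x i j = 1) (i : Fin N) (j : Fin M) :
    x i j ≤ 1 := by
  rw [← hx1 j]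
  exact Finset.single_le_sum (f := fun i => x i j) (fun k _ => hx0 k j) (Finset.mem_univ i)

/-- A weighted sum of entries bounded by `C`, with weights in `[0,1]`, is at most `M * C`. -/
lemma sum_mul_le_card_mul_s11 {M : ℕ} {a x : Fin M → ℝ} {C : ℝ} (hC : 0 ≤ C)
    (ha : ∀ j, a j ≤ C) (hx0 : ∀ j, 0 ≤ x j) (hx1 : ∀ j, x j ≤ 1) :
    ∑ j, a j * x j ≤ M * C := by
  calc ∑ j, a j * x j ≤ ∑ _j : Fin M, C := Finset.sum_le_sum fun j _ =>
        (mul_le_mul_of_nonneg_right (ha j) (hx0 j)).trans (mul_le_of_le_one_right hC (hx1 j))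
    _ = M * C := by simp

/-- Entries are bounded by the sup norm. -/
lemma entry_le_norm {N M : ℕ} (A : Fin N → Fin M → ℝ) (i : Fin N) (j : Fin M) :
    A i j ≤ ‖A‖ :=
  (Real.le_norm_self _).trans ((norm_le_pi_norm (A i) j).trans (norm_le_pi_norm A i))

/-- If every utility drops by at most `e`, a feasible point can be moved, keeping `x`, to one whose
objective value is at least `z - N * e`. -/
lemma HWFeasible.exists_of_utility_le {N M : ℕ} {L Lt x : Fin N → Fin M → ℝ} {Δ B z w e : ℝ}
    {v d : Fin N → ℝ} (hN : 0 < N) (hΔ : 0 < Δ) (hB : 0 ≤ B)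
    (h : HWFeasible L Δ (B + Δ) x z v w d)
    (hu0 : ∀ i, 0 ≤ ∑ j, Lt i j * x i j) (huB : ∀ i, ∑ j, Lt i j * x i j ≤ B)
    (hue : ∀ i, (∑ j, L i j * x i j) - e ≤ ∑ j, Lt i j * x i j) :
    ∃ z' v' w' d', HWFeasible Lt Δ (B + Δ) x z' v' w' d' ∧ z - N * e ≤ z' := by
  obtain ⟨hx, -, -, hw, hd, hz, h1, h2⟩ := h
  set u' : Fin N → ℝ := fun i => ∑ j, Lt i j * x i j with hu'
  set w' := max 0 (w - e) with hw'
  have hw0 : 0 ≤ w' := le_max_left _ _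
  have hwe : w - e ≤ w' := le_max_right _ _
  have hwu : ∀ i, w' ≤ u' i := fun i => max_le (hu0 i) (by
    have := (h1 i).2
    have := (h2 i).1
    have := mul_nonneg hΔ.le (hd i).1
    have := hue i
    simp only [hu']
    linarith)
  have hS : 0 < B + Δ := by linarith
  set d' : Fin N → ℝ := fun i => (u' i - w') / (B + Δ) with hd'
  have hdS : ∀ i, d' i * (B + Δ) = u' i - w' := fun i => div_mul_cancel₀ _ hS.ne'
  have hd0 : ∀ i, 0 ≤ d' i := fun i => div_nonneg (sub_nonneg.2 (hwu i)) hS.le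
  have hd1 : ∀ i, d' i ≤ 1 := fun i => (div_le_one hS).2 (by
    have : u' i ≤ B := huB i
    linarith)
  have hBd : ∀ i, 0 ≤ B * d' i := fun i => mul_nonneg hB (hd0 i)
  have hv : ∀ i, v i - e ≤ w' + B * d' i := fun i => by
    have hue' : (∑ j, L i j * x i j) - e ≤ u' i := hue i
    have ha := mul_le_mul_of_nonneg_left (h1 i).2 hB
    have hb := mul_le_mul_of_nonneg_left (h2 i).2 hΔ.le
    have hc := mul_le_mul_of_nonneg_left hue' hB
    have hf := mul_le_mul_of_nonneg_left hwe hΔ.le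
    have hg : B * (d' i * (B + Δ)) = B * (u' i - w') := by rw [hdS i]
    refine le_of_mul_le_mul_right ?_ hS
    linarith
  have hsum : (∑ i, v i) - N * e ≤ ∑ i, (w' + B * d' i) := by
    calc (∑ i, v i) - N * e = ∑ i, (v i - e) := by simp [Finset.sum_sub_distrib]
      _ ≤ _ := Finset.sum_le_sum fun i _ => hv i
  have hv0 : ∀ i, 0 ≤ w' + B * d' i := fun i => add_nonneg hw0 (hBd i)
  have hN1 : (0 : ℝ) ≤ N - 1 := sub_nonneg.2 (by exact_mod_cast hN)
  refine ⟨(N - 1 : ℝ) * Δ + ∑ i, (w' + B * d' i), fun i => w' + B * d' i, w', d',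
    ⟨hx, add_nonneg (mul_nonneg hN1 hΔ.le) (Finset.sum_nonneg fun i _ => hv0 i), hv0, hw0,
      fun i => ⟨hd0 i, hd1 i⟩, le_rfl, fun i => ?_, fun i => ?_⟩, by linarith⟩
  · have := hdS i
    have := mul_le_mul_of_nonneg_left (hd1 i) hΔ.le
    change u' i - Δ ≤ w' + B * d' i ∧ w' + B * d' i ≤ u' i - Δ * d' i
    constructor <;> linarith
  · have := hBd i
    constructor <;> linarith

/-- one-sided Lipschitz bound for the Hooker–Williams
social-welfare LP value. -/
theorem HW_value_lipschitz
    (N M : ℕ) (hN : 0 < N) (hM : 0 < M)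
    (Lbar Δ : ℝ) (hLbar : 0 < Lbar) (hΔ : 0 < Δ)
    (Γ : ℝ) (hΓ : Γ = 2 * M * Lbar + Δ)
    (L Lt : Fin N → Fin M → ℝ)
    (hL0 : ∀ i j, 0 ≤ L i j) (hLt0 : ∀ i j, 0 ≤ Lt i j)
    (hL : ‖L‖ ≤ Lbar) (hLt : ‖Lt‖ ≤ Lbar)
    (E : ℝ) (hE : E = ‖L - Lt‖) (hsmall : M * E < Δ / 4)
    (zL zLt : ℝ)
    (hzL : IsGreatest {z : ℝ | ∃ x v w d, HWFeasible L Δ Γ x z v w d} zL)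
    (hzLt : IsGreatest {z : ℝ | ∃ x v w d, HWFeasible Lt Δ Γ x z v w d} zLt) :
    zL - zLt ≤ N * M * E := by
  subst hΓ hE
  obtain ⟨x, v, w, d, h⟩ := hzL.1
  have hx0 := h.1.1
  have hx1 := entry_le_one_of_column_sum hx0 h.1.2
  have hM0 : (0 : ℝ) ≤ M * Lbar := by positivity
  obtain ⟨z', v', w', d', h', hz'⟩ := h.exists_of_utility_le (Lt := Lt) (e := M * ‖L - Lt‖)
    hN hΔ (by positivity)
    (fun i => Finset.sum_nonneg fun j _ => mul_nonneg (hLt0 i j) (hx0 i j))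
    (fun i => by
      have := sum_mul_le_card_mul_s11 hLbar.le (fun j => (entry_le_norm Lt i j).trans hLt)
        (hx0 i) (hx1 i)
      linarith)
    (fun i => by
      have := sum_mul_le_card_mul_s11 (norm_nonneg (L - Lt)) (entry_le_norm (L - Lt) i)
        (hx0 i) (hx1 i)
      simp only [Pi.sub_apply, sub_mul, Finset.sum_sub_distrib] at this
      linarith)
  have := hzLt.2 ⟨x, v', w', d', h'⟩
  linarith
end

section
/- Let N, M be positive integers, R ∈ ℝ^{N×M}, R̂ ∈ ℝ_{≥0}^{N×M}, and x*, x̂ ∈ Δ_N^M with ∑_{i,j} R̂_{i,j} x*_{i,j} ≤ ∑_{i,j} R̂_{i,j} x̂_{i,j}. Let ε ∈ [0, 1/N] and define x_t ∈ Δ_N^M entrywise by x_{t,i,j} = (1 − N·ε)·x̂_{i,j} + ε. Then ∑_{i,j} R_{i,j} x*_{i,j} − ∑_{i,j} R_{i,j} x_{t,i,j} ≤ 3·M·‖R − R̂‖_∞ + N·M·ε·‖R‖_∞. -/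
open Finset

/-- A pairing with nonnegative weights of constant column sum `s` is at most `M * s` times the
entrywise supremum norm. -/
theorem sum_mul_le_norm_of_column_sum {N M : ℕ} (A w : Fin N → Fin M → ℝ) {s : ℝ}
    (hw : ∀ i j, 0 ≤ w i j) (hs : ∀ j, ∑ i, w i j = s) :
    ∑ i, ∑ j, A i j * w i j ≤ M * s * ‖A‖ := by
  have hA : ∀ i j, A i j ≤ ‖A‖ := fun i j =>
    (le_abs_self _).trans ((norm_le_pi_norm (A i) j).trans (norm_le_pi_norm A i))
  calc ∑ i, ∑ j, A i j * w i j ≤ ∑ i, ∑ j, ‖A‖ * w i j :=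
        sum_le_sum fun i _ => sum_le_sum fun j _ => mul_le_mul_of_nonneg_right (hA i j) (hw i j)
    _ = M * s * ‖A‖ := by
        rw [sum_comm]
        simp only [← mul_sum, hs, sum_const, card_univ, Fintype.card_fin, nsmul_eq_mul]
        ring

/-- per-round revenue-regret bound for the
relaxation-then-exploration recommendation (Eq. (EC.15)). -/
theorem per_round_revenue_regret_bound
    (N M : ℕ) (hN : 0 < N) (hM : 0 < M)
    (R Rhat : Fin N → Fin M → ℝ) (hRhat0 : ∀ i j, 0 ≤ Rhat i j)
    (xstar xhat : Fin N → Fin M → ℝ)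
    (hxstar0 : ∀ i j, 0 ≤ xstar i j) (hxstar1 : ∀ i j, xstar i j ≤ 1)
    (hxstarsum : ∀ j, ∑ i, xstar i j = 1)
    (hxhat0 : ∀ i j, 0 ≤ xhat i j) (hxhat1 : ∀ i j, xhat i j ≤ 1)
    (hxhatsum : ∀ j, ∑ i, xhat i j = 1)
    (hle : ∑ i, ∑ j, Rhat i j * xstar i j ≤ ∑ i, ∑ j, Rhat i j * xhat i j)
    (ε : ℝ) (hε0 : 0 ≤ ε) (hε1 : ε ≤ 1 / (N : ℝ))
    (xt : Fin N → Fin M → ℝ)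
    (hxt : ∀ i j, xt i j = (1 - (N : ℝ) * ε) * xhat i j + ε) :
    (∑ i, ∑ j, R i j * xstar i j) - (∑ i, ∑ j, R i j * xt i j) ≤
      3 * M * ‖R - Rhat‖ + N * M * ε * ‖R‖ := by
  have hstar := sum_mul_le_norm_of_column_sum (R - Rhat) xstar hxstar0 hxstarsum
  have hhat := sum_mul_le_norm_of_column_sum (Rhat - R) xhat hxhat0 hxhatsum
  have hone := sum_mul_le_norm_of_column_sum (Rhat - R) (fun _ _ => 1) (s := N)
    (fun _ _ => zero_le_one) (fun _ => by simp)
  have hR := sum_mul_le_norm_of_column_sum R xhat hxhat0 hxhatsum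
  rw [norm_sub_rev] at hhat hone
  simp only [Pi.sub_apply, sub_mul, mul_one, sum_sub_distrib] at hstar hhat hone hR
  have hRhat : 0 ≤ ∑ i, ∑ j, Rhat i j := sum_nonneg fun i _ => sum_nonneg fun j _ => hRhat0 i j
  have hxtsum : ∑ i, ∑ j, R i j * xt i j =
      (1 - N * ε) * ∑ i, ∑ j, R i j * xhat i j + ε * ∑ i, ∑ j, R i j := by
    simp only [hxt, mul_sum, ← sum_add_distrib]
    exact sum_congr rfl fun i _ => sum_congr rfl fun j _ => by ring
  have hNε : N * ε ≤ 1 := by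
    rwa [le_div_iff₀ (by positivity), mul_comm] at hε1
  have hexploit : N * ε * ∑ i, ∑ j, R i j * xhat i j ≤ N * ε * (M * ‖R‖) :=
    mul_le_mul_of_nonneg_left hR (by positivity)
  have hexplore : ε * -∑ i, ∑ j, R i j ≤ ε * (M * N * ‖R - Rhat‖) :=
    mul_le_mul_of_nonneg_left (by linarith) hε0
  have hshrink : N * ε * (M * ‖R - Rhat‖) ≤ 1 * (M * ‖R - Rhat‖) :=
    mul_le_mul_of_nonneg_right hNε (by positivity)
  rw [hxtsum]
  linarith
end
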